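/- arXiv:2411.14646 — 3 statements merged into one kernel-verified Lean document; each statement's English description precedes it below -/
import Mathlib

section
/- Let α ∈ (0,1/2) and let X₁,…,Xₙ be integrable random variables. Put S = X₁+⋯+Xₙ, t = ex_α(X₁)+⋯+ex_α(Xₙ), and let F_S(y) = P(S ≤ y) be the distribution function of S. Assume S is not P-almost surely equal to t. Define, for y ∈ ℝ, F̃_S(y) = (y·F_S(y) − E[S·1_{S≤y}]) / (2·(y·F_S(y) − E[S·1_{S≤y}]) + E[S] − y). Then DQ^ex_α(X₁,…,Xₙ) = (1 − F̃_S(t))/α. -/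
open MeasureTheory

variable {Ω : Type*} [MeasurableSpace Ω]

/-- `t` is the `α`-expectile of `X` under `P`:
`(1−α)·E[(X−t)₊] = α·E[(X−t)₋]`. -/
def IsExpectile (P : Measure Ω) (α : ℝ) (X : Ω → ℝ) (t : ℝ) : Prop :=
  (1 - α) * ∫ ω, max (X ω - t) 0 ∂P = α * ∫ ω, max (t - X ω) 0 ∂P

/-- The expectile-based diversification quotient `DQ^ex_α(X₁,…,Xₙ) = α*/α`, where
`α* = inf {β ∈ (0,1) : ex_β(∑ᵢ Xᵢ) ≤ ∑ᵢ ex_α(Xᵢ)}` with the convention `inf ∅ = 1`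
(implemented by adjoining `1` to the set, which does not change a nonempty infimum since
the set, when nonempty, has infimum at most `1`). Here `ex` is the expectile functional. -/
noncomputable def DQex (P : Measure Ω) (ex : ℝ → (Ω → ℝ) → ℝ) (α : ℝ)
    {n : ℕ} (X : Fin n → Ω → ℝ) : ℝ :=
  sInf ({β : ℝ | β ∈ Set.Ioo (0:ℝ) 1 ∧
      ex β (fun ω => ∑ i, X i ω) ≤ ∑ i, ex α (X i)} ∪ {1}) / α

theorem expectile_le_iff (P : Measure Ω) [IsProbabilityMeasure P] (β : ℝ) (hβ : β ∈ Set.Ioo (0:ℝ) 1)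
    (Y : Ω → ℝ) (hY : Integrable Y P) (e t : ℝ) (he : IsExpectile P β Y e) :
    e ≤ t ↔ (1 - β) * ∫ ω, max (Y ω - t) 0 ∂P ≤ β * ∫ ω, max (t - Y ω) 0 ∂P := by
  have ip : ∀ s : ℝ, Integrable (fun ω => max (Y ω - s) 0) P := fun s =>
    (hY.sub (integrable_const s)).pos_part
  have im : ∀ s : ℝ, Integrable (fun ω => max (s - Y ω) 0) P := fun s =>
    ((integrable_const s).sub hY).pos_part
  have hb0 := hβ.1
  have hb1 := hβ.2
  have key : ∀ s s' : ℝ, s ≤ s' →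
      (1 - β) * (∫ ω, max (Y ω - s') 0 ∂P) - β * (∫ ω, max (s' - Y ω) 0 ∂P)
        + β * (1 - β) * (s' - s) ≤
      (1 - β) * (∫ ω, max (Y ω - s) 0 ∂P) - β * (∫ ω, max (s - Y ω) 0 ∂P) := by
    intro s s' hs
    have e1 : ∀ r : ℝ, (1 - β) * (∫ ω, max (Y ω - r) 0 ∂P) - β * (∫ ω, max (r - Y ω) 0 ∂P)
        = ∫ ω, ((1 - β) * max (Y ω - r) 0 - β * max (r - Y ω) 0) ∂P := by
      intro r
      rw [integral_sub ((ip r).const_mul _) ((im r).const_mul _), integral_const_mul,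
        integral_const_mul]
    have ig : ∀ r : ℝ, Integrable (fun ω => (1 - β) * max (Y ω - r) 0 - β * max (r - Y ω) 0) P :=
      fun r => ((ip r).const_mul _).sub ((im r).const_mul _)
    have e2 : β * (1 - β) * (s' - s) = ∫ ω, β * (1 - β) * (s' - s) ∂P := by simp
    rw [e1, e1, e2, ← integral_add (ig s') (integrable_const _)]
    apply integral_mono ((ig s').add (integrable_const _)) (ig s)
    intro ω
    simp only [Pi.add_apply]
    have h1 : 0 ≤ (1 - β) * (1 - β) * (s' - s) := by
      have : 0 ≤ s' - s := by linarith
      have : 0 ≤ 1 - β := by linarith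
      positivity
    have h2 : 0 ≤ β * β * (s' - s) := by
      have : 0 ≤ s' - s := by linarith
      positivity
    rcases le_total (Y ω) s with h | h
    · have h' : Y ω ≤ s' := h.trans hs
      rw [max_eq_right (by linarith), max_eq_left (by linarith), max_eq_right (by linarith),
        max_eq_left (by linarith)]
      nlinarith
    · rcases le_total (Y ω) s' with h' | h'
      · rw [max_eq_right (by linarith), max_eq_left (by linarith), max_eq_left (by linarith),
          max_eq_right (by linarith)]
        nlinarith [mul_nonneg (sq_nonneg β) (sub_nonneg.2 h'),
          mul_nonneg (sq_nonneg (1 - β)) (sub_nonneg.2 h)]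
      · rw [max_eq_left (by linarith), max_eq_right (by linarith), max_eq_left (by linarith),
          max_eq_right (by linarith)]
        nlinarith
  unfold IsExpectile at he
  constructor
  · intro h
    have := key e t h
    have : 0 ≤ β * (1 - β) * (t - e) := by
      have : 0 ≤ t - e := by linarith
      have : 0 ≤ 1 - β := by linarith
      positivity
    linarith
  · intro h
    by_contra! hc
    have := key t e hc.le
    have : 0 < β * (1 - β) * (e - t) := by
      have : 0 < e - t := by linarith
      have : 0 < 1 - β := by linarith
      positivity
    linarith

/-- the distribution-function formula DQ^ex_α(X) = (1 − F̃_S(t))/α,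
where F̃_S is the transform of the distribution function of S. -/
theorem stmt1
    (P : Measure Ω) [IsProbabilityMeasure P]
    (α : ℝ) (hα : α ∈ Set.Ioo (0:ℝ) (1/2))
    {n : ℕ} (X : Fin n → Ω → ℝ) (hX : ∀ i, Integrable (X i) P)
    (ex : ℝ → (Ω → ℝ) → ℝ)
    (hex : ∀ β ∈ Set.Ioo (0:ℝ) 1, ∀ Y : Ω → ℝ, Integrable Y P → IsExpectile P β Y (ex β Y))
    (S : Ω → ℝ) (hS : ∀ ω, S ω = ∑ i, X i ω)
    (t : ℝ) (ht : t = ∑ i, ex α (X i))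
    (hnd : ¬ (∀ᵐ ω ∂P, S ω = t))
    (F : ℝ → ℝ) (hF : ∀ y, F y = (P {ω | S ω ≤ y}).toReal)
    (Ftil : ℝ → ℝ)
    (hFtil : ∀ y, Ftil y =
      (y * F y - ∫ ω in {ω | S ω ≤ y}, S ω ∂P) /
        (2 * (y * F y - ∫ ω in {ω | S ω ≤ y}, S ω ∂P) + (∫ ω, S ω ∂P) - y)) :
    DQex P ex α X = (1 - Ftil t) / α := by
  obtain rfl : S = fun ω => ∑ i, X i ω := funext hS
  set S : Ω → ℝ := fun ω => ∑ i, X i ω with hSdef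
  have hSi : Integrable S P := integrable_finsetSum _ fun i _ => hX i
  have ip : Integrable (fun ω => max (S ω - t) 0) P := (hSi.sub (integrable_const t)).pos_part
  have im : Integrable (fun ω => max (t - S ω) 0) P := ((integrable_const t).sub hSi).pos_part
  set a := ∫ ω, max (S ω - t) 0 ∂P with ha
  set b := ∫ ω, max (t - S ω) 0 ∂P with hb
  have ha0 : 0 ≤ a := integral_nonneg fun ω => le_max_right _ _
  have hb0 : 0 ≤ b := integral_nonneg fun ω => le_max_right _ _
  have hab : a - b = (∫ ω, S ω ∂P) - t := by
    rw [ha, hb, ← integral_sub ip im]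
    have : ∀ ω, max (S ω - t) 0 - max (t - S ω) 0 = S ω - t := by
      intro ω
      rcases le_total (S ω) t with h | h
      · rw [max_eq_right (by linarith), max_eq_left (by linarith)]; ring
      · rw [max_eq_left (by linarith), max_eq_right (by linarith)]; ring
    simp_rw [this]
    rw [integral_sub hSi (integrable_const t)]
    simp
  have hbF : t * F t - ∫ ω in {ω | S ω ≤ t}, S ω ∂P = b := by
    have hm : NullMeasurableSet {ω | S ω ≤ t} P :=
      nullMeasurableSet_le hSi.aemeasurable aemeasurable_const
    have : (fun ω => max (t - S ω) 0) = Set.indicator {ω | S ω ≤ t} (fun ω => t - S ω) := by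
      ext ω
      by_cases h : S ω ≤ t
      · rw [Set.indicator_of_mem (by exact h), max_eq_left (by linarith)]
      · rw [Set.indicator_of_notMem (by exact h), max_eq_right (by linarith)]
    rw [hb, this, integral_indicator₀ hm, integral_sub (integrable_const t) hSi.integrableOn, hF]
    simp [Measure.real, mul_comm]
  have hpos : 0 < a + b := by
    rcases (add_nonneg ha0 hb0).lt_or_eq with h | h
    · exact h
    · exfalso
      apply hnd
      have ha' : a = 0 := by linarith
      have hb' : b = 0 := by linarith
      have h1 := (integral_eq_zero_iff_of_nonneg (fun ω => le_max_right _ _) ip).1 ha'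
      have h2 := (integral_eq_zero_iff_of_nonneg (fun ω => le_max_right _ _) im).1 hb'
      filter_upwards [h1, h2] with ω h1 h2
      simp only [Pi.zero_apply] at h1 h2
      have h3 := le_max_left (S ω - t) 0
      have h4 := le_max_left (t - S ω) 0
      linarith
  have hval : 1 - Ftil t = a / (a + b) := by
    rw [hFtil, hbF, show 2 * b + (∫ ω, S ω ∂P) - t = a + b by linarith]
    field_simp
    ring
  rw [hval]
  unfold DQex
  congr 1
  rw [← ht]
  have hc1 : a / (a + b) ≤ 1 := by rw [div_le_one hpos]; linarith
  have hc0 : 0 ≤ a / (a + b) := by positivity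
  have hiff : ∀ β ∈ Set.Ioo (0:ℝ) 1, (ex β S ≤ t ↔ a / (a + b) ≤ β) := by
    intro β hβ
    rw [expectile_le_iff P β hβ S hSi (ex β S) t (hex β hβ S hSi), div_le_iff₀ hpos]
    constructor <;> intro h <;> linarith
  refine IsGLB.csInf_eq ?_ ⟨(1:ℝ), Set.mem_union_right _ rfl⟩
  constructor
  · rintro β (⟨h, h'⟩ | h)
    · exact (hiff β h).1 h'
    · rw [Set.mem_singleton_iff.1 h]; exact hc1
  · intro d hd
    by_contra! hc
    have hd1 : d ≤ 1 := hd (Or.inr rfl)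
    have hm : (a / (a + b) + d) / 2 ∈ Set.Ioo (0:ℝ) 1 := ⟨by linarith, by linarith⟩
    have := hd (Or.inl ⟨hm, (hiff _ hm).2 (by linarith)⟩)
    linarith
end

section
/- Let α ∈ (0,1/2) and let X₁,…,Xₙ be integrable random variables such that X₁+⋯+Xₙ is non-degenerate. Then α·DQ^ex_α(X₁,…,Xₙ) + (1−α)·DQ^ex_{1−α}(−X₁,…,−Xₙ) = 1. -/
open MeasureTheory

variable {Ω : Type*} [MeasurableSpace Ω]

lemma intPos (P : Measure Ω) [IsProbabilityMeasure P] {Y : Ω → ℝ} (hY : Integrable Y P) (t : ℝ) :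
    Integrable (fun ω => max (Y ω - t) 0) P :=
  (hY.sub (integrable_const t)).pos_part

lemma intNeg (P : Measure Ω) [IsProbabilityMeasure P] {Y : Ω → ℝ} (hY : Integrable Y P) (t : ℝ) :
    Integrable (fun ω => max (t - Y ω) 0) P :=
  ((integrable_const t).sub hY).pos_part

lemma int_diff (P : Measure Ω) [IsProbabilityMeasure P] {Y : Ω → ℝ} (hY : Integrable Y P) (t : ℝ) :
    ∫ ω, max (Y ω - t) 0 ∂P - ∫ ω, max (t - Y ω) 0 ∂P = ∫ ω, Y ω ∂P - t := by
  rw [← integral_sub (intPos P hY t) (intNeg P hY t)]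
  have h : ∀ ω, max (Y ω - t) 0 - max (t - Y ω) 0 = Y ω - t := by
    intro ω
    rcases le_total (Y ω) t with h | h
    · rw [max_eq_right (by linarith), max_eq_left (by linarith)]; ring
    · rw [max_eq_left (by linarith), max_eq_right (by linarith)]; ring
  simp_rw [h]
  rw [integral_sub hY (integrable_const t)]
  simp

lemma g_strict (P : Measure Ω) [IsProbabilityMeasure P] {Y : Ω → ℝ} (hY : Integrable Y P)
    {β : ℝ} (hβ : β ∈ Set.Ioo (0:ℝ) 1) {s t : ℝ} (hst : s < t) :
    (1 - β) * ∫ ω, max (Y ω - t) 0 ∂P - β * ∫ ω, max (t - Y ω) 0 ∂P <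
    (1 - β) * ∫ ω, max (Y ω - s) 0 ∂P - β * ∫ ω, max (s - Y ω) 0 ∂P := by
  have h1 : ∫ ω, max (Y ω - t) 0 ∂P ≤ ∫ ω, max (Y ω - s) 0 ∂P :=
    integral_mono (intPos P hY t) (intPos P hY s)
      (fun ω => max_le_max (by linarith) le_rfl)
  have h2 : ∫ ω, max (s - Y ω) 0 ∂P ≤ ∫ ω, max (t - Y ω) 0 ∂P :=
    integral_mono (intNeg P hY s) (intNeg P hY t)
      (fun ω => max_le_max (by linarith) le_rfl)
  have h3 := int_diff P hY s
  have h4 := int_diff P hY t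
  obtain ⟨hb0, hb1⟩ := hβ
  generalize ∫ ω, max (Y ω - t) 0 ∂P = At at *
  generalize ∫ ω, max (Y ω - s) 0 ∂P = As at *
  generalize ∫ ω, max (t - Y ω) 0 ∂P = Bt at *
  generalize ∫ ω, max (s - Y ω) 0 ∂P = Bs at *
  rcases lt_or_eq_of_le h1 with h | h
  · nlinarith [mul_pos (sub_pos.2 hb1) (sub_pos.2 h), mul_nonneg hb0.le (sub_nonneg.2 h2)]
  · have : Bs < Bt := by linarith
    subst h
    nlinarith [mul_pos hb0 (sub_pos.2 this)]

lemma ex_le_iff (P : Measure Ω) [IsProbabilityMeasure P] {Y : Ω → ℝ} (hY : Integrable Y P)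
    {β : ℝ} (hβ : β ∈ Set.Ioo (0:ℝ) 1) {e : ℝ} (he : IsExpectile P β Y e) (t : ℝ) :
    e ≤ t ↔ (1 - β) * ∫ ω, max (Y ω - t) 0 ∂P ≤ β * ∫ ω, max (t - Y ω) 0 ∂P := by
  unfold IsExpectile at he
  constructor
  · intro h
    rcases lt_or_eq_of_le h with h | h
    · have := g_strict P hY hβ h
      linarith
    · subst h; exact he.le
  · intro h
    by_contra hc
    have := g_strict P hY hβ (not_le.1 hc)
    linarith

lemma ex_unique (P : Measure Ω) [IsProbabilityMeasure P] {Y : Ω → ℝ} (hY : Integrable Y P)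
    {β : ℝ} (hβ : β ∈ Set.Ioo (0:ℝ) 1) {e f : ℝ} (he : IsExpectile P β Y e)
    (hf : IsExpectile P β Y f) : e = f :=
  le_antisymm ((ex_le_iff P hY hβ he f).2 (le_of_eq hf)) ((ex_le_iff P hY hβ hf e).2 (le_of_eq he))

lemma ex_neg (P : Measure Ω) {Y : Ω → ℝ} {β e : ℝ} (he : IsExpectile P β Y e) :
    IsExpectile P (1 - β) (fun ω => -(Y ω)) (-e) := by
  unfold IsExpectile at *
  have h1 : ∀ ω, -Y ω - -e = e - Y ω := fun ω => by ring
  have h2 : ∀ ω, -e - -Y ω = Y ω - e := fun ω => by ring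
  simp_rw [h1, h2]
  linarith

lemma sInf_aux {A B : ℝ} (hA : 0 ≤ A) (hB : 0 ≤ B) (hAB : 0 < A + B) (p : ℝ → Prop)
    (hp : ∀ β ∈ Set.Ioo (0:ℝ) 1, (p β ↔ (1 - β) * A ≤ β * B)) :
    sInf ({β : ℝ | β ∈ Set.Ioo (0:ℝ) 1 ∧ p β} ∪ {1}) = A / (A + B) := by
  have hr0 : 0 ≤ A / (A + B) := by positivity
  have hr1 : A / (A + B) ≤ 1 := by rw [div_le_one hAB]; linarith
  have hp' : ∀ β ∈ Set.Ioo (0:ℝ) 1, (p β ↔ A / (A + B) ≤ β) := by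
    intro β hβ
    rw [hp β hβ, div_le_iff₀ hAB]
    constructor <;> intro h <;> linarith
  apply csInf_eq_of_forall_ge_of_forall_gt_exists_lt
  · exact ⟨1, Or.inr rfl⟩
  · rintro β (⟨h, h'⟩ | h)
    · exact (hp' β h).1 h'
    · rw [Set.mem_singleton_iff.1 h]; exact hr1
  · intro w hw
    by_cases h1 : 1 < w
    · exact ⟨1, Or.inr rfl, h1⟩
    · have hm : (A / (A + B) + w) / 2 ∈ Set.Ioo (0:ℝ) 1 := ⟨by linarith, by linarith⟩
      exact ⟨_, Or.inl ⟨hm, (hp' _ hm).2 (by linarith)⟩, by linarith⟩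

lemma AB_pos (P : Measure Ω) [IsProbabilityMeasure P] {Y : Ω → ℝ} (hY : Integrable Y P)
    (hnd : ¬ ∃ c : ℝ, ∀ᵐ ω ∂P, Y ω = c) (t : ℝ) :
    0 < ∫ ω, max (Y ω - t) 0 ∂P + ∫ ω, max (t - Y ω) 0 ∂P := by
  have hA : 0 ≤ ∫ ω, max (Y ω - t) 0 ∂P := integral_nonneg (fun ω => le_max_right _ _)
  have hB : 0 ≤ ∫ ω, max (t - Y ω) 0 ∂P := integral_nonneg (fun ω => le_max_right _ _)
  by_contra hc
  apply hnd
  have h10 : ∫ ω, max (Y ω - t) 0 ∂P = 0 := by linarith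
  have h1 := (integral_eq_zero_iff_of_nonneg (fun ω => le_max_right _ _) (intPos P hY t)).1 h10
  have h20 : ∫ ω, max (t - Y ω) 0 ∂P = 0 := by linarith
  have h2 := (integral_eq_zero_iff_of_nonneg (fun ω => le_max_right _ _) (intNeg P hY t)).1 h20
  refine ⟨t, ?_⟩
  filter_upwards [h1, h2] with ω a b
  have a' : max (Y ω - t) 0 = 0 := a
  have b' : max (t - Y ω) 0 = 0 := b
  have := max_eq_right_iff.1 a'
  have := max_eq_right_iff.1 b'
  linarith

/-- the symmetry relation
α·DQ^ex_α(X) + (1−α)·DQ^ex_{1−α}(−X) = 1 for a non-degenerate total loss. -/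
theorem stmt6
    (P : Measure Ω) [IsProbabilityMeasure P]
    (α : ℝ) (hα : α ∈ Set.Ioo (0:ℝ) (1/2))
    {n : ℕ} (X : Fin n → Ω → ℝ) (hX : ∀ i, Integrable (X i) P)
    (hnd : ¬ ∃ c : ℝ, ∀ᵐ ω ∂P, (∑ i, X i ω) = c)
    (ex : ℝ → (Ω → ℝ) → ℝ)
    (hex : ∀ β ∈ Set.Ioo (0:ℝ) 1, ∀ Y : Ω → ℝ, Integrable Y P → IsExpectile P β Y (ex β Y)) :
    α * DQex P ex α X + (1 - α) * DQex P ex (1 - α) (fun i ω => -(X i ω)) = 1 := by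
  obtain ⟨h0, h2⟩ := hα
  have hα1 : α ∈ Set.Ioo (0:ℝ) 1 := ⟨h0, by linarith⟩
  have hα2 : 1 - α ∈ Set.Ioo (0:ℝ) 1 := ⟨by linarith, by linarith⟩
  have hS : Integrable (fun ω => ∑ i, X i ω) P := integrable_finsetSum _ (fun i _ => hX i)
  have hT : ∑ i, ex (1 - α) (fun ω => -(X i ω)) = -∑ i, ex α (X i) := by
    rw [← Finset.sum_neg_distrib]
    refine Finset.sum_congr rfl (fun i _ => ?_)
    exact ex_unique P (hX i).neg hα2 (hex _ hα2 _ (hX i).neg) (ex_neg P (hex _ hα1 _ (hX i)))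
  have hN : (fun ω => ∑ i, -(X i ω)) = fun ω => -(∑ i, X i ω) := by
    funext ω; rw [Finset.sum_neg_distrib]
  unfold DQex
  rw [hT, hN]
  generalize ∑ i, ex α (X i) = T
  have hpos := AB_pos P hS hnd T
  have hA : 0 ≤ ∫ ω, max ((∑ i, X i ω) - T) 0 ∂P := integral_nonneg (fun ω => le_max_right _ _)
  have hB : 0 ≤ ∫ ω, max (T - (∑ i, X i ω)) 0 ∂P := integral_nonneg (fun ω => le_max_right _ _)
  rw [sInf_aux hA hB hpos (fun β => ex β (fun ω => ∑ i, X i ω) ≤ T)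
    (fun β hβ => ex_le_iff P hS hβ (hex β hβ _ hS) T)]
  rw [sInf_aux hB hA (by linarith) (fun β => ex β (fun ω => -(∑ i, X i ω)) ≤ -T)
    (fun β hβ => by
      have := ex_le_iff P hS.neg hβ (hex β hβ _ hS.neg) (-T)
      have e1 : ∀ ω, -(∑ i, X i ω) - -T = T - ∑ i, X i ω := fun ω => by ring
      have e2 : ∀ ω, -T - -(∑ i, X i ω) = (∑ i, X i ω) - T := fun ω => by ring
      simp only [Pi.neg_apply, e1, e2] at this
      exact this)]
  rw [mul_div_cancel₀ _ h0.ne', mul_div_cancel₀ _ hα2.1.ne']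
  rw [add_comm (∫ ω, max (T - (∑ i, X i ω)) 0 ∂P), ← add_div, div_self hpos.ne']
end

section
/- Let α ∈ (0,1/2), let Y be an integrable non-degenerate random variable, let μ₁,…,μₙ ∈ ℝ, σ₁,…,σₙ ≥ 0 and s > 0. Let X₁,…,Xₙ be integrable random variables such that Xᵢ has the same distribution as μᵢ + σᵢ·Y for each i, and X₁+⋯+Xₙ has the same distribution as (μ₁+⋯+μₙ) + s·Y. Put k = (σ₁+⋯+σₙ)/s. Then DQ^ex_α(X₁,…,Xₙ) = E[(Y − k·ex_α(Y))₊] / (α·E[|Y − k·ex_α(Y)|]). -/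
open MeasureTheory

variable {Ω : Type*} [MeasurableSpace Ω]

lemma aux_int {P : Measure Ω} [IsProbabilityMeasure P] {Z : Ω → ℝ} (hZ : Integrable Z P) (c : ℝ) :
    Integrable (fun ω => max (Z ω - c) 0) P ∧ Integrable (fun ω => max (c - Z ω) 0) P :=
  ⟨(hZ.sub (integrable_const c)).pos_part, ((integrable_const c).sub hZ).pos_part⟩

lemma aux_diff {P : Measure Ω} [IsProbabilityMeasure P] {Z : Ω → ℝ} (hZ : Integrable Z P) (c : ℝ) :
    ∫ ω, max (Z ω - c) 0 ∂P - ∫ ω, max (c - Z ω) 0 ∂P = ∫ ω, Z ω ∂P - c := by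
  rw [← integral_sub (aux_int hZ c).1 (aux_int hZ c).2]
  have : ∫ ω, Z ω ∂P - c = ∫ ω, (Z ω - c) ∂P := by
    rw [integral_sub hZ (integrable_const c)]; simp
  rw [this]
  congr 1
  funext ω
  rcases le_total (Z ω) c with h | h
  · rw [max_eq_right (by linarith), max_eq_left (by linarith)]; ring
  · rw [max_eq_left (by linarith), max_eq_right (by linarith)]; ring

lemma aux_mono {P : Measure Ω} [IsProbabilityMeasure P] {Z : Ω → ℝ} (hZ : Integrable Z P)
    {t c : ℝ} (h : t ≤ c) :
    ∫ ω, max (Z ω - c) 0 ∂P ≤ ∫ ω, max (Z ω - t) 0 ∂P ∧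
    ∫ ω, max (t - Z ω) 0 ∂P ≤ ∫ ω, max (c - Z ω) 0 ∂P := by
  constructor
  · refine integral_mono (aux_int hZ c).1 (aux_int hZ t).1 fun ω => ?_
    exact max_le_max (by linarith) le_rfl
  · refine integral_mono (aux_int hZ t).2 (aux_int hZ c).2 fun ω => ?_
    exact max_le_max (by linarith) le_rfl

lemma aux_le_iff {P : Measure Ω} [IsProbabilityMeasure P] {Z : Ω → ℝ} (hZ : Integrable Z P)
    {β t : ℝ} (hβ : β ∈ Set.Ioo (0:ℝ) 1) (ht : IsExpectile P β Z t) (c : ℝ) :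
    t ≤ c ↔ (1 - β) * ∫ ω, max (Z ω - c) 0 ∂P ≤ β * ∫ ω, max (c - Z ω) 0 ∂P := by
  obtain ⟨h0, h1⟩ := hβ
  unfold IsExpectile at ht
  constructor
  · intro h
    obtain ⟨m1, m2⟩ := aux_mono hZ h
    have := mul_le_mul_of_nonneg_left m1 (by linarith : (0:ℝ) ≤ 1 - β)
    have := mul_le_mul_of_nonneg_left m2 h0.le
    linarith
  · intro h
    by_contra hc
    push Not at hc
    obtain ⟨m1, m2⟩ := aux_mono hZ hc.le
    have d1 := aux_diff hZ t
    have d2 := aux_diff hZ c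
    generalize ∫ ω, max (Z ω - c) 0 ∂P = a at *
    generalize ∫ ω, max (Z ω - t) 0 ∂P = b at *
    generalize ∫ ω, max (c - Z ω) 0 ∂P = d at *
    generalize ∫ ω, max (t - Z ω) 0 ∂P = e at *
    have e1 : a ≤ b := by
      by_contra hh
      push Not at hh
      have := mul_lt_mul_of_pos_left hh (by linarith : (0:ℝ) < 1 - β)
      have := mul_le_mul_of_nonneg_left m2 h0.le
      linarith
    have e2 : e ≤ d := by
      by_contra hh
      push Not at hh
      have := mul_le_mul_of_nonneg_left m1 (by linarith : (0:ℝ) ≤ 1 - β)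
      have := mul_lt_mul_of_pos_left hh h0
      linarith
    linarith

lemma aux_unique {P : Measure Ω} [IsProbabilityMeasure P] {Z : Ω → ℝ} (hZ : Integrable Z P)
    {β t u : ℝ} (hβ : β ∈ Set.Ioo (0:ℝ) 1) (ht : IsExpectile P β Z t) (hu : IsExpectile P β Z u) :
    t = u :=
  le_antisymm ((aux_le_iff hZ hβ ht u).2 (le_of_eq hu)) ((aux_le_iff hZ hβ hu t).2 (le_of_eq ht))

lemma aux_trans {P : Measure Ω} {Z Y : Ω → ℝ} {m σ : ℝ} (hσ : 0 ≤ σ)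
    (h : ProbabilityTheory.IdentDistrib Z (fun ω => m + σ * Y ω) P P) (c : ℝ) :
    ∫ ω, max (Z ω - (m + σ * c)) 0 ∂P = σ * ∫ ω, max (Y ω - c) 0 ∂P ∧
    ∫ ω, max ((m + σ * c) - Z ω) 0 ∂P = σ * ∫ ω, max (c - Y ω) 0 ∂P := by
  constructor
  · have := (h.comp (u := fun x => max (x - (m + σ * c)) 0) (by fun_prop)).integral_eq
    simp only [Function.comp_def] at this
    rw [this, ← integral_const_mul]
    congr 1
    funext ω
    rw [mul_max_of_nonneg _ _ hσ]
    congr 1 <;> ring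
  · have := (h.comp (u := fun x => max ((m + σ * c) - x) 0) (by fun_prop)).integral_eq
    simp only [Function.comp_def] at this
    rw [this, ← integral_const_mul]
    congr 1
    funext ω
    rw [mul_max_of_nonneg _ _ hσ]
    congr 1 <;> ring

open ProbabilityTheory in
/-- elliptical-type location–scale model: if each Xᵢ ~ μᵢ + σᵢY and
∑ᵢ Xᵢ ~ (∑ᵢ μᵢ) + sY with k = (∑ᵢ σᵢ)/s, then
DQ^ex_α(X) = E[(Y − k·ex_α(Y))₊]/(α·E[|Y − k·ex_α(Y)|]). -/
theorem stmt11
    (P : Measure Ω) [IsProbabilityMeasure P]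
    (α : ℝ) (hα : α ∈ Set.Ioo (0:ℝ) (1/2))
    (Y : Ω → ℝ) (hY : Integrable Y P)
    (hYnd : ¬ ∃ c : ℝ, ∀ᵐ ω ∂P, Y ω = c)
    {n : ℕ} (μv σv : Fin n → ℝ) (hσ : ∀ i, 0 ≤ σv i)
    (s : ℝ) (hs : 0 < s)
    (X : Fin n → Ω → ℝ) (hX : ∀ i, Integrable (X i) P)
    (hXd : ∀ i, IdentDistrib (X i) (fun ω => μv i + σv i * Y ω) P P)
    (hSd : IdentDistrib (fun ω => ∑ i, X i ω) (fun ω => (∑ i, μv i) + s * Y ω) P P)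
    (ex : ℝ → (Ω → ℝ) → ℝ)
    (hex : ∀ β ∈ Set.Ioo (0:ℝ) 1, ∀ Z : Ω → ℝ, Integrable Z P → IsExpectile P β Z (ex β Z))
    (k : ℝ) (hk : k = (∑ i, σv i) / s) :
    DQex P ex α X =
      (∫ ω, max (Y ω - k * ex α Y) 0 ∂P) /
        (α * ∫ ω, |Y ω - k * ex α Y| ∂P) := by
  obtain ⟨h0, h2⟩ := hα
  have hα1 : α ∈ Set.Ioo (0:ℝ) 1 := ⟨h0, by linarith⟩
  have hexY := hex α hα1 Y hY
  set t := ex α Y with ht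
  have hexX : ∀ i, ex α (X i) = μv i + σv i * t := by
    intro i
    refine aux_unique (hX i) hα1 (hex α hα1 _ (hX i)) ?_
    obtain ⟨a1, a2⟩ := aux_trans (hσ i) (hXd i) t
    unfold IsExpectile at hexY ⊢
    rw [a1, a2]
    linear_combination σv i * hexY
  have hsum : ∑ i, ex α (X i) = (∑ i, μv i) + s * (k * t) := by
    simp only [hexX, Finset.sum_add_distrib, ← Finset.sum_mul]
    rw [hk]
    field_simp
  have hS : Integrable (fun ω => ∑ i, X i ω) P := integrable_finsetSum _ fun i _ => hX i
  unfold DQex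
  rw [hsum]
  set c := k * t with hc
  obtain ⟨a1, a2⟩ := aux_trans hs.le hSd c
  have hA : 0 ≤ ∫ ω, max (Y ω - c) 0 ∂P := integral_nonneg fun ω => le_max_right _ _
  have hB : 0 ≤ ∫ ω, max (c - Y ω) 0 ∂P := integral_nonneg fun ω => le_max_right _ _
  have habs : ∫ ω, |Y ω - c| ∂P = ∫ ω, max (Y ω - c) 0 ∂P + ∫ ω, max (c - Y ω) 0 ∂P := by
    rw [← integral_add (aux_int hY c).1 (aux_int hY c).2]
    congr 1
    funext ω
    rcases le_total (Y ω) c with h | h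
    · rw [max_eq_right (by linarith), max_eq_left (by linarith), abs_of_nonpos (by linarith)]; ring
    · rw [max_eq_left (by linarith), max_eq_right (by linarith), abs_of_nonneg (by linarith)]; ring
  have hpos : 0 < ∫ ω, |Y ω - c| ∂P := by
    refine lt_of_le_of_ne (integral_nonneg fun ω => abs_nonneg _) fun h => hYnd ⟨c, ?_⟩
    have := (integral_eq_zero_iff_of_nonneg (fun ω => abs_nonneg _)
      (hY.sub (integrable_const c)).abs).1 h.symm
    filter_upwards [this] with ω hω
    have : Y ω - c = 0 := abs_eq_zero.1 hω
    linarith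
  have hiff : ∀ β ∈ Set.Ioo (0:ℝ) 1, (ex β (fun ω => ∑ i, X i ω) ≤ (∑ i, μv i) + s * c ↔
      (∫ ω, max (Y ω - c) 0 ∂P) / (∫ ω, |Y ω - c| ∂P) ≤ β) := by
    intro β hβ
    rw [aux_le_iff hS hβ (hex β hβ _ hS), a1, a2, div_le_iff₀ hpos, habs]
    constructor
    · intro h
      have : s * ((1 - β) * ∫ ω, max (Y ω - c) 0 ∂P) ≤ s * (β * ∫ ω, max (c - Y ω) 0 ∂P) := by
        linarith
      have := le_of_mul_le_mul_left this hs
      linarith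
    · intro h
      have : ((1 - β) * ∫ ω, max (Y ω - c) 0 ∂P) ≤ (β * ∫ ω, max (c - Y ω) 0 ∂P) := by
        linarith
      have := mul_le_mul_of_nonneg_left this hs.le
      linarith
  have hr0 : 0 ≤ (∫ ω, max (Y ω - c) 0 ∂P) / (∫ ω, |Y ω - c| ∂P) := div_nonneg hA hpos.le
  have hr1 : (∫ ω, max (Y ω - c) 0 ∂P) / (∫ ω, |Y ω - c| ∂P) ≤ 1 := by
    rw [div_le_one hpos, habs]; linarith
  rw [mul_comm α, ← div_div]
  congr 1
  generalize (∫ ω, max (Y ω - c) 0 ∂P) / (∫ ω, |Y ω - c| ∂P) = r at *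
  refine csInf_eq_of_forall_ge_of_forall_gt_exists_lt ⟨1, Or.inr rfl⟩ ?_ ?_
  · rintro β (⟨hβ, h⟩ | h)
    · exact (hiff β hβ).1 h
    · rw [Set.mem_singleton_iff] at h; rw [h]; exact hr1
  · intro w hw
    by_cases h1 : w ≤ 1
    · have hβ : (r + w) / 2 ∈ Set.Ioo (0:ℝ) 1 := ⟨by linarith, by linarith⟩
      exact ⟨(r + w) / 2, Or.inl ⟨hβ, (hiff _ hβ).2 (by linarith)⟩, by linarith⟩
    · exact ⟨1, Or.inr rfl, by linarith⟩
end
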